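/- Let f : ℝ → ℝ be 2π-periodic with V_{−π}^{π}(f) ≤ B, and suppose its variation function satisfies ϖ⁻(v_f,x,δ) ≤ ω(δ) and ϖ⁺(v_f,x,δ) ≤ ω(δ) for all 0 < δ ≤ π at a point x, where ω is non-decreasing and ϖ^± are the one-sided local quasi-moduli. Then for every n ≥ 1 and every δ ∈ (0,π], |S_n f(x) − (f(x+0)+f(x−0))/2| ≤ (2B/(πn))(1 + 6 cot(δ/2)) + 16 ω(δ), where S_n f is the n-th partial sum of the Fourier series of f. -/

import Mathlib

open Set Filter Topology

/-- The `n`-th partial Fourier sum `S_n f(x) = a_0/2 + Σ_{k=1}^n (a_k cos kx + b_k sin kx)`. -/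
noncomputable def fourierPartialSum (f : ℝ → ℝ) (n : ℕ) (x : ℝ) : ℝ :=
  (1 / (2 * Real.pi)) * (∫ t in (-Real.pi)..Real.pi, f t) +
    ∑ k ∈ Finset.Icc 1 n,
      (((1 / Real.pi) * ∫ t in (-Real.pi)..Real.pi, f t * Real.cos (k * t)) * Real.cos (k * x)
        + ((1 / Real.pi) * ∫ t in (-Real.pi)..Real.pi, f t * Real.sin (k * t)) * Real.sin (k * x))


lemma abel_piece (g V h H : ℝ → ℝ) (s t M K : ℝ) (hst : s ≤ t)
    (hg : ∀ u ∈ Icc s t, |g u - g s| ≤ V t - V s)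
    (hgi : IntervalIntegrable g MeasureTheory.volume s t)
    (hh : Continuous h) (hH : ∀ u, HasDerivAt H (-h u) u)
    (hM : |H t| ≤ M) (hK : ∀ u ∈ Icc s t, |h u| ≤ K) :
    |(∫ u in s..t, g u * h u) + g t * H t - g s * H s| ≤ (M + K * (t - s)) * (V t - V s) := by
  have h1 : ∫ u in s..t, -h u = H t - H s :=
    intervalIntegral.integral_eq_sub_of_hasDerivAt (fun u _ => hH u)
      (hh.neg.intervalIntegrable _ _)
  rw [intervalIntegral.integral_neg] at h1
  have h2 : ∫ u in s..t, (g u - g s) * h u = (∫ u in s..t, g u * h u) - g s * ∫ u in s..t, h u := by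
    rw [← intervalIntegral.integral_const_mul, ← intervalIntegral.integral_sub]
    · congr 1; ext u; ring
    · exact hgi.mul_continuousOn hh.continuousOn
    · exact (hh.const_mul _).intervalIntegrable _ _
  have h3 : |∫ u in s..t, (g u - g s) * h u| ≤ ((V t - V s) * K) * |t - s| := by
    rw [← Real.norm_eq_abs]
    apply intervalIntegral.norm_integral_le_of_norm_le_const
    intro u hu
    rw [uIoc_of_le hst] at hu
    have hu' := Ioc_subset_Icc_self hu
    rw [Real.norm_eq_abs, abs_mul]
    exact mul_le_mul (hg u hu') (hK u hu') (abs_nonneg _) ((abs_nonneg _).trans (hg u hu'))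
  have h4 : (∫ u in s..t, g u * h u) + g t * H t - g s * H s
      = (∫ u in s..t, (g u - g s) * h u) + (g t - g s) * H t := by
    rw [h2]; linear_combination -g s * h1
  rw [abs_of_nonneg (sub_nonneg.2 hst)] at h3
  have h5 : |(g t - g s) * H t| ≤ (V t - V s) * M := by
    rw [abs_mul]
    have := hg t ⟨hst, le_rfl⟩
    exact mul_le_mul this hM (abs_nonneg _) ((abs_nonneg _).trans this)
  rw [h4]
  calc _ ≤ _ := abs_add_le _ _
    _ ≤ _ := add_le_add h3 h5
    _ = _ := by ring

lemma bv_integrable (g V : ℝ → ℝ) (a b : ℝ) (hab : a ≤ b)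
    (hg : ∀ s t, a ≤ s → s ≤ t → t ≤ b → |g t - g s| ≤ V t - V s) :
    IntervalIntegrable g MeasureTheory.volume a b := by
  have h1 : MonotoneOn V (uIcc a b) := by
    rw [uIcc_of_le hab]
    intro s hs t ht hst
    have := (abs_nonneg _).trans (hg s t hs.1 hst ht.2)
    linarith
  have h2 : MonotoneOn (fun t => V t - g t) (uIcc a b) := by
    rw [uIcc_of_le hab]
    intro s hs t ht hst
    have := (le_abs_self _).trans (hg s t hs.1 hst ht.2)
    simp only; linarith
  have := h1.intervalIntegrable.sub h2.intervalIntegrable (μ := MeasureTheory.volume)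
  refine this.congr ?_
  intro u _
  simp

lemma abel_ineq (g V h H : ℝ → ℝ) (a b M : ℝ) (hab : a ≤ b)
    (hg : ∀ s t, a ≤ s → s ≤ t → t ≤ b → |g t - g s| ≤ V t - V s)
    (hh : Continuous h) (hH : ∀ u, HasDerivAt H (-h u) u)
    (hM : ∀ u ∈ Icc a b, |H u| ≤ M) :
    |(∫ u in a..b, g u * h u) + g b * H b - g a * H a| ≤ M * (V b - V a) := by
  obtain ⟨K, hK⟩ := isCompact_Icc.exists_bound_of_continuousOn (s := Icc a b) hh.continuousOn
  have key : ∀ N : ℕ, |(∫ u in a..b, g u * h u) + g b * H b - g a * H a| ≤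
      (M + K * (b - a) * (1 / ((N:ℝ) + 1))) * (V b - V a) := by
    intro N
    set p : ℕ → ℝ := fun i => a + i * ((b - a) / ((N:ℝ) + 1)) with hp
    have hN : (0:ℝ) < (N:ℝ) + 1 := by positivity
    have hstep : 0 ≤ (b - a) / ((N:ℝ) + 1) := div_nonneg (by linarith) hN.le
    have hp0 : p 0 = a := by simp [hp]
    have hpN : p (N+1) = b := by simp only [hp]; push_cast; field_simp; ring
    have hmono : Monotone p := by
      intro i j hij
      have : (i:ℝ) ≤ j := by exact_mod_cast hij
      simp only [hp]
      have := mul_le_mul_of_nonneg_right this hstep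
      linarith
    have hps : ∀ i, p (i+1) - p i = (b - a) * (1 / ((N:ℝ) + 1)) := by
      intro i; simp only [hp]; push_cast; ring
    have hint : ∀ i < N + 1, IntervalIntegrable g MeasureTheory.volume (p i) (p (i+1)) := by
      intro i hi
      apply bv_integrable g V _ _ (hmono (Nat.le_succ i))
      intro s t h1 h2 h3
      refine hg s t (le_trans ?_ h1) h2 (h3.trans ?_)
      · rw [← hp0]; exact hmono (Nat.zero_le _)
      · rw [← hpN]; exact hmono hi
    have hsum : (∫ u in a..b, g u * h u) + g b * H b - g a * H a = ∑ i ∈ Finset.range (N+1),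
        ((∫ u in (p i)..(p (i+1)), g u * h u) + g (p (i+1)) * H (p (i+1)) - g (p i) * H (p i)) := by
      have e1 := intervalIntegral.sum_integral_adjacent_intervals (f := fun u => g u * h u)
        (μ := MeasureTheory.volume) (a := p) (n := N+1)
        (fun i hi => (hint i hi).mul_continuousOn hh.continuousOn)
      have e2 := Finset.sum_range_sub (fun i => g (p i) * H (p i)) (N+1)
      simp only [add_sub_assoc]
      rw [Finset.sum_add_distrib, e1, e2, hp0, hpN]
    have hsV := Finset.sum_range_sub (fun i => V (p i)) (N+1)
    rw [hsum]
    calc _ ≤ _ := Finset.abs_sum_le_sum_abs _ _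
      _ ≤ ∑ i ∈ Finset.range (N+1), (M + K * (b - a) * (1 / ((N:ℝ) + 1))) * (V (p (i+1)) - V (p i)) := by
        apply Finset.sum_le_sum
        intro i hi
        have hi := Finset.mem_range.1 hi
        have hl : a ≤ p i := by rw [← hp0]; exact hmono (Nat.zero_le _)
        have hr : p (i+1) ≤ b := by rw [← hpN]; exact hmono hi
        have hm := hmono (Nat.le_succ i)
        have := abel_piece g V h H (p i) (p (i+1)) M K hm ?_ (hint i hi) hh hH (hM _ ⟨hl.trans hm, hr⟩)
          (fun u hu => hK u ⟨hl.trans hu.1, hu.2.trans hr⟩)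
        · rw [hps] at this
          rw [mul_assoc K]; exact this
        · intro u hu
          have q1 := hg (p i) u hl hu.1 (hu.2.trans hr)
          have q2 := (abs_nonneg _).trans (hg u (p (i+1)) (hl.trans hu.1) hu.2 hr)
          linarith
      _ = _ := by rw [← Finset.mul_sum, hsV, hp0, hpN]
  have hlim : Tendsto (fun N : ℕ => (M + K * (b - a) * (1 / ((N:ℝ) + 1))) * (V b - V a)) atTop
      (𝓝 ((M + K * (b - a) * 0) * (V b - V a))) :=
    ((tendsto_one_div_add_atTop_nhds_zero_nat.const_mul _).const_add _).mul_const _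
  have := ge_of_tendsto' hlim key
  simpa using this

noncomputable def dirD (n : ℕ) (t : ℝ) : ℝ := 1/2 + ∑ k ∈ Finset.Icc 1 n, Real.cos (k * t)
noncomputable def dirH (n : ℕ) (t : ℝ) : ℝ :=
  (Real.pi - t)/2 - ∑ k ∈ Finset.Icc 1 n, Real.sin (k * t) / k

lemma dirD_cont (n : ℕ) : Continuous (dirD n) := by unfold dirD; fun_prop

lemma dirH_deriv (n : ℕ) (u : ℝ) : HasDerivAt (dirH n) (-dirD n u) u := by
  unfold dirH dirD
  have h1 : HasDerivAt (fun t : ℝ => (Real.pi - t)/2) (-1/2) u :=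
    ((hasDerivAt_id u).const_sub Real.pi).div_const 2
  have h2 : HasDerivAt (fun t : ℝ => ∑ k ∈ Finset.Icc 1 n, Real.sin (k * t) / k)
      (∑ k ∈ Finset.Icc 1 n, Real.cos (k * u)) u := by
    apply HasDerivAt.fun_sum
    intro k hk
    have hk0 : (k:ℝ) ≠ 0 := by
      have := (Finset.mem_Icc.1 hk).1
      positivity
    have := (((hasDerivAt_id u).const_mul (k:ℝ)).sin).div_const (k:ℝ)
    refine HasDerivAt.congr_deriv this ?_
    simp only [id, mul_one]; field_simp
  refine HasDerivAt.congr_deriv (h1.sub h2) ?_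
  ring

lemma dirH_zero (n : ℕ) : dirH n 0 = Real.pi / 2 := by simp [dirH]
lemma dirH_pi (n : ℕ) : dirH n Real.pi = 0 := by simp [dirH, Real.sin_nat_mul_pi]

lemma dirD_mul (n : ℕ) (t : ℝ) : dirD n t * (2 * Real.sin (t/2)) = Real.sin ((n + 1/2) * t) := by
  unfold dirD
  induction n with
  | zero => simp; ring_nf
  | succ n ih =>
    rw [Finset.sum_Icc_succ_top (by omega), ← add_assoc, add_mul, ih]
    have e1 : (n + 1/2 : ℝ) * t = ((n+1:ℕ):ℝ) * t - t/2 := by push_cast; ring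
    have e2 : (((n+1:ℕ):ℝ) + 1/2 : ℝ) * t = ((n+1:ℕ):ℝ) * t + t/2 := by ring
    rw [e1, e2, Real.sin_sub, Real.sin_add]; ring

lemma dirD_even (n : ℕ) (t : ℝ) : dirD n (-t) = dirD n t := by simp [dirD]

lemma dirD_le (n : ℕ) (t : ℝ) : |dirD n t| ≤ n + 1/2 := by
  unfold dirD
  calc _ ≤ _ := abs_add_le _ _
    _ ≤ 1/2 + ∑ k ∈ Finset.Icc 1 n, (1:ℝ) := by
      gcongr
      · rw [abs_of_pos (by norm_num)]
      · exact (Finset.abs_sum_le_sum_abs _ _).trans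
          (Finset.sum_le_sum fun k _ => Real.abs_cos_le_one _)
    _ = _ := by simp; ring

lemma dirH_le (n : ℕ) (t : ℝ) (ht : t ∈ Ioc 0 Real.pi) :
    |dirH n t| ≤ 1 / ((n + 1/2) * Real.sin (t/2)) := by
  have hN : (0:ℝ) < n + 1/2 := by positivity
  have hsin : ∀ u, t ≤ u → u ≤ Real.pi → 0 < Real.sin (u/2) := fun u h1 h2 =>
    Real.sin_pos_of_pos_of_lt_pi (by linarith [ht.1]) (by linarith [ht.1])
  have hmon : ∀ s u, t ≤ s → s ≤ u → u ≤ Real.pi → Real.sin (s/2) ≤ Real.sin (u/2) := by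
    intro s u h1 h2 h3
    apply Real.sin_le_sin_of_le_of_le_pi_div_two <;> linarith [ht.1, Real.pi_pos]
  have hI : ∫ u in t..Real.pi, -dirD n u = dirH n Real.pi - dirH n t :=
    intervalIntegral.integral_eq_sub_of_hasDerivAt (fun u _ => dirH_deriv n u)
      ((dirD_cont n).neg.intervalIntegrable _ _)
  rw [intervalIntegral.integral_neg, dirH_pi] at hI
  have h := abel_ineq (fun s => 1 / (2 * Real.sin (s/2))) (fun s => -(1 / (2 * Real.sin (s/2))))
    (fun s => Real.sin ((n+1/2) * s)) (fun s => Real.cos ((n+1/2)*s) / (n+1/2)) t Real.pi (1/(n+1/2))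
    ht.2 ?_ (by fun_prop) ?_ ?_
  · have hJ : ∫ u in t..Real.pi, 1 / (2 * Real.sin (u/2)) * Real.sin ((n+1/2) * u)
        = ∫ u in t..Real.pi, dirD n u := by
      apply intervalIntegral.integral_congr
      intro u hu
      rw [uIcc_of_le ht.2] at hu
      have := hsin u hu.1 hu.2
      simp only
      rw [← dirD_mul]; field_simp
    rw [hJ] at h
    have hc : Real.cos ((n+1/2) * Real.pi) = 0 := by
      rw [Real.cos_eq_zero_iff]; exact ⟨n, by push_cast; ring⟩
    rw [hc] at h
    have e : ∫ u in t..Real.pi, dirD n u = dirH n t := by linarith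
    rw [e] at h
    simp only [zero_div, mul_zero, add_zero] at h
    have hst := hsin t le_rfl ht.2
    have hsp : Real.sin (Real.pi/2) = 1 := Real.sin_pi_div_two
    rw [hsp] at h
    have h6 : |1 / (2 * Real.sin (t/2)) * (Real.cos ((n+1/2)*t) / (n+1/2))| ≤
        1 / (2 * Real.sin (t/2)) * (1 / (n+1/2)) := by
      rw [abs_mul, abs_of_pos (by positivity : 0 < 1 / (2 * Real.sin (t/2))), abs_div, abs_of_pos hN]
      gcongr
      exact Real.abs_cos_le_one _
    have e7 : 1 / ((n + 1/2) * Real.sin (t/2)) = 1 / (2 * Real.sin (t/2)) * (1 / ((n:ℝ)+1/2)) +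
       1 / ((n:ℝ)+1/2) * (1 / (2 * Real.sin (t/2))) := by field_simp; norm_num
    have h8 : 0 < 1/((n:ℝ)+1/2) := by positivity
    have h9 : 1 / ((n:ℝ)+1/2) * (-(1/(2*1)) - -(1 / (2 * Real.sin (t/2)))) ≤ 1 / ((n:ℝ)+1/2) * (1 / (2 * Real.sin (t/2))) := by
      gcongr; linarith
    rw [e7]
    have h' := h.trans h9
    rw [abs_le] at h' h6 ⊢
    constructor <;> linarith [h'.1, h'.2, h6.1, h6.2]
  · intro s u h1 h2 h3
    have a1 := hsin s h1 (h2.trans h3)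
    have := hmon s u h1 h2 h3
    have : 1 / (2 * Real.sin (u/2)) ≤ 1 / (2 * Real.sin (s/2)) := by gcongr
    rw [abs_of_nonpos (by linarith)]; linarith
  · intro u
    have := (((hasDerivAt_id u).const_mul ((n:ℝ)+1/2)).cos).div_const ((n:ℝ)+1/2)
    refine HasDerivAt.congr_deriv this ?_
    simp only [id, mul_one]; field_simp
  · intro u _
    rw [abs_div, abs_of_pos hN]
    gcongr
    exact Real.abs_cos_le_one _

lemma dirH_unif (n : ℕ) (hn : 1 ≤ n) (t : ℝ) (ht : t ∈ Icc 0 Real.pi) : |dirH n t| ≤ Real.pi + 1 := by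
  have hN : (0:ℝ) < n + 1/2 := by positivity
  have hn' : (1:ℝ) ≤ n := by exact_mod_cast hn
  have hpi := Real.pi_gt_three
  have hbig : ∀ u, 1/((n:ℝ)+1/2) ≤ u → u ≤ Real.pi → |dirH n u| ≤ Real.pi := by
    intro u h1 h2
    have hu : 0 < u := lt_of_lt_of_le (by positivity) h1
    refine (dirH_le n u ⟨hu, h2⟩).trans ?_
    have h3 := Real.mul_le_sin (x := u/2) (by linarith) (by linarith)
    have h3' : u / Real.pi ≤ Real.sin (u/2) := by
      calc u / Real.pi = 2 / Real.pi * (u/2) := by ring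
        _ ≤ _ := h3
    have h4 : 1 ≤ ((n:ℝ)+1/2) * u := by
      rw [div_le_iff₀ hN] at h1; linarith
    have h5 : 0 < u / Real.pi := by positivity
    have h6 := h5.trans_le h3'
    rw [div_le_iff₀ (by positivity)]
    calc (1:ℝ) ≤ ((n:ℝ)+1/2) * u := h4
      _ = Real.pi * (((n:ℝ)+1/2) * (u/Real.pi)) := by field_simp
      _ ≤ _ := by gcongr
  rcases le_total (1/((n:ℝ)+1/2)) t with h | h
  · linarith [hbig t h ht.2]
  · have hq : 1/((n:ℝ)+1/2) ≤ Real.pi := by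
      rw [div_le_iff₀ hN]; nlinarith
    have h1 := hbig _ le_rfl hq
    have h2 := Convex.norm_image_sub_le_of_norm_hasDerivWithin_le (f := dirH n) (s := univ)
      (f' := fun u => -dirD n u) (C := (n:ℝ)+1/2) (x := 1/((n:ℝ)+1/2)) (y := t)
      (fun u _ => (dirH_deriv n u).hasDerivWithinAt)
      (fun u _ => by rw [norm_neg]; exact dirD_le n u) convex_univ (mem_univ _) (mem_univ _)
    rw [Real.norm_eq_abs, Real.norm_eq_abs, abs_of_nonpos (by linarith : t - 1/((n:ℝ)+1/2) ≤ 0)] at h2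
    have h3 : ((n:ℝ)+1/2) * -(t - 1/((n:ℝ)+1/2)) ≤ 1 := by
      have : ((n:ℝ)+1/2) * (1/((n:ℝ)+1/2)) = 1 := by field_simp
      nlinarith [ht.1, mul_nonneg hN.le ht.1]
    have h4 := abs_sub_abs_le_abs_sub (dirH n t) (dirH n (1/((n:ℝ)+1/2)))
    linarith

lemma one_side (g W : ℝ → ℝ) (l w δ : ℝ) (n : ℕ) (hn : 1 ≤ n) (hδ : δ ∈ Ioc 0 Real.pi)
    (hg : ∀ s t, 0 < s → s ≤ t → t ≤ Real.pi → |g t - g s| ≤ W t - W s)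
    (hl : Tendsto g (𝓝[>] 0) (𝓝 l)) (hw : Tendsto W (𝓝[>] 0) (𝓝 w)) :
    |(∫ u in (0:ℝ)..Real.pi, g u * dirD n u) - l * (Real.pi/2)| ≤
      (Real.pi + 1) * (W δ - w) + 1 / ((n+1/2) * Real.sin (δ/2)) * (W Real.pi - W δ) := by
  set g' := Function.update g 0 l with hg'
  set W' := Function.update W 0 w with hW'
  have eg : ∀ s, 0 < s → g' s = g s := fun s hs => Function.update_of_ne hs.ne' _ _
  have eW : ∀ s, 0 < s → W' s = W s := fun s hs => Function.update_of_ne hs.ne' _ _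
  have eg0 : g' 0 = l := Function.update_self _ _ _
  have eW0 : W' 0 = w := Function.update_self _ _ _
  have hmain : ∀ s t, 0 ≤ s → s ≤ t → t ≤ Real.pi → |g' t - g' s| ≤ W' t - W' s := by
    intro s t h1 h2 h3
    rcases h1.eq_or_lt with h | h
    · subst h
      rcases h2.eq_or_lt with h | h
      · subst h; simp
      · rw [eg0, eW0, eg t h, eW t h]
        refine le_of_tendsto_of_tendsto ((hl.const_sub (g t)).abs) (hw.const_sub (W t)) ?_
        filter_upwards [Ioo_mem_nhdsGT h] with s hs
        exact hg s t hs.1 hs.2.le h3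
    · rw [eg s h, eW s h, eg t (h.trans_le h2), eW t (h.trans_le h2)]
      exact hg s t h h2 h3
  have hsδ : 0 < Real.sin (δ/2) :=
    Real.sin_pos_of_pos_of_lt_pi (by linarith [hδ.1]) (by linarith [hδ.1, hδ.2])
  have a1 := abel_ineq g' W' (dirD n) (dirH n) 0 δ (Real.pi + 1) hδ.1.le
    (fun s t h1 h2 h3 => hmain s t h1 h2 (h3.trans hδ.2)) (dirD_cont n) (dirH_deriv n)
    (fun u hu => dirH_unif n hn u ⟨hu.1, hu.2.trans hδ.2⟩)
  have a2 := abel_ineq g' W' (dirD n) (dirH n) δ Real.pi (1 / ((n+1/2) * Real.sin (δ/2))) hδ.2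
    (fun s t h1 h2 h3 => hmain s t (hδ.1.le.trans h1) h2 h3) (dirD_cont n) (dirH_deriv n) (by
      intro u hu
      refine (dirH_le n u ⟨hδ.1.trans_le hu.1, hu.2⟩).trans ?_
      have : Real.sin (δ/2) ≤ Real.sin (u/2) := by
        apply Real.sin_le_sin_of_le_of_le_pi_div_two <;> linarith [hδ.1, hu.1, hu.2, Real.pi_pos]
      gcongr)
  have hi : ∀ a b, 0 ≤ a → a ≤ b → b ≤ Real.pi →
      IntervalIntegrable (fun u => g' u * dirD n u) MeasureTheory.volume a b := by
    intro a b h1 h2 h3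
    exact (bv_integrable g' W' a b h2 (fun s t q1 q2 q3 =>
      hmain s t (h1.trans q1) q2 (q3.trans h3))).mul_continuousOn (dirD_cont n).continuousOn
  have hadd := intervalIntegral.integral_add_adjacent_intervals
    (hi 0 δ le_rfl hδ.1.le hδ.2) (hi δ Real.pi hδ.1.le hδ.2 le_rfl)
  have hcongr : ∫ u in (0:ℝ)..Real.pi, g u * dirD n u = ∫ u in (0:ℝ)..Real.pi, g' u * dirD n u := by
    apply intervalIntegral.integral_congr_ae
    refine Eventually.of_forall ?_
    intro u hu
    rw [uIoc_of_le Real.pi_pos.le] at hu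
    rw [eg u hu.1]
  rw [hcongr, ← hadd]
  rw [eg0, eW0, eW δ hδ.1, dirH_zero] at a1
  rw [eW δ hδ.1, eW _ Real.pi_pos, dirH_pi] at a2
  rw [abs_le] at a1 a2 ⊢
  constructor <;> linarith [a1.1, a1.2, a2.1, a2.2]

lemma evar_shift (f : ℝ → ℝ) (c a b : ℝ) (hc : ∀ t, f (t + c) = f t) :
    eVariationOn f (Icc (a + c) (b + c)) = eVariationOn f (Icc a b) := by
  have h := eVariationOn.comp_eq_of_monotoneOn f (t := Icc a b) (fun t => t + c)
    (fun s _ t _ h => by simpa using h)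
  rw [image_add_const_Icc] at h
  rw [← h]
  congr 1
  ext t; exact hc t

lemma evar_period (f : ℝ → ℝ) (hper : Function.Periodic f (2 * Real.pi)) (x : ℝ) :
    eVariationOn f (Icc (x - Real.pi) (x + Real.pi)) = eVariationOn f (Icc (-Real.pi) Real.pi) := by
  have hpi := Real.pi_pos
  obtain ⟨k, hk, -⟩ := existsUnique_add_zsmul_mem_Ico (by positivity : 0 < 2 * Real.pi) x 0
  set y := x + k • (2 * Real.pi) with hy
  have h1 := evar_shift f (k • (2 * Real.pi)) (x - Real.pi) (x + Real.pi) (fun t => hper.zsmul k t)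
  rw [← h1]
  have e1 : x - Real.pi + k • (2 * Real.pi) = y - Real.pi := by rw [hy]; ring
  have e2 : x + Real.pi + k • (2 * Real.pi) = y + Real.pi := by rw [hy]; ring
  rw [e1, e2]
  have hk1 := hk.1
  have hk2 := hk.2
  have A := eVariationOn.Icc_add_Icc f (s := univ) (a := y - Real.pi) (b := Real.pi)
    (c := y + Real.pi) (by linarith) (by linarith) (mem_univ _)
  have A' := eVariationOn.Icc_add_Icc f (s := univ) (a := -Real.pi) (b := y - Real.pi)
    (c := Real.pi) (by linarith) (by linarith) (mem_univ _)
  have C := evar_shift f (2 * Real.pi) (-Real.pi) (y - Real.pi) hper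
  rw [show -Real.pi + 2 * Real.pi = Real.pi by ring,
    show y - Real.pi + 2 * Real.pi = y + Real.pi by ring] at C
  simp only [univ_inter] at A A'
  rw [← A, ← A', C, add_comm]

lemma fps_eq (f : ℝ → ℝ) (hper : Function.Periodic f (2 * Real.pi)) (x : ℝ) (n : ℕ)
    (hf : IntervalIntegrable f MeasureTheory.volume (x - Real.pi) (x + Real.pi)) :
    fourierPartialSum f n x = (1 / Real.pi) * ((∫ u in (0:ℝ)..Real.pi, f (x + u) * dirD n u) +
      ∫ u in (0:ℝ)..Real.pi, f (x - u) * dirD n u) := by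
  have hpi := Real.pi_pos
  have hall : ∀ a b, IntervalIntegrable f MeasureTheory.volume a b := by
    intro a b
    refine hper.intervalIntegrable (by positivity) (t := x - Real.pi) ?_ a b
    rwa [show x - Real.pi + 2 * Real.pi = x + Real.pi by ring]
  have h1 : fourierPartialSum f n x =
      (1 / Real.pi) * ∫ t in (-Real.pi)..Real.pi, f t * dirD n (t - x) := by
    have e : ∀ t, f t * dirD n (t - x) = (1/2) * f t + ∑ k ∈ Finset.Icc 1 n,
        ((f t * Real.cos (k * t)) * Real.cos (k * x)
          + (f t * Real.sin (k * t)) * Real.sin (k * x)) := by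
      intro t
      unfold dirD
      rw [mul_add, Finset.mul_sum]
      congr 1
      · ring
      · apply Finset.sum_congr rfl
        intro k _
        rw [mul_sub, Real.cos_sub]; ring
    have ic : ∀ k : ℕ, IntervalIntegrable (fun t => (f t * Real.cos (k * t)) * Real.cos (k * x))
        MeasureTheory.volume (-Real.pi) Real.pi := fun k =>
      ((hall _ _).mul_continuousOn (by fun_prop)).mul_const _
    have is : ∀ k : ℕ, IntervalIntegrable (fun t => (f t * Real.sin (k * t)) * Real.sin (k * x))
        MeasureTheory.volume (-Real.pi) Real.pi := fun k =>
      ((hall _ _).mul_continuousOn (by fun_prop)).mul_const _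
    simp_rw [e]
    rw [intervalIntegral.integral_add ((hall _ _).const_mul _)
      (by
        have := IntervalIntegrable.sum (Finset.Icc 1 n) (fun k _ => (ic k).add (is k))
        refine this.congr ?_
        intro t _
        simp [Finset.sum_apply]),
      intervalIntegral.integral_finsetSum (fun k _ => (ic k).add (is k)), mul_add, Finset.mul_sum]
    unfold fourierPartialSum
    congr 1
    · rw [intervalIntegral.integral_const_mul]; field_simp
    · apply Finset.sum_congr rfl
      intro k _
      rw [intervalIntegral.integral_add (ic k) (is k), intervalIntegral.integral_mul_const,
        intervalIntegral.integral_mul_const]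
      ring
  have hp : Function.Periodic (fun t => f t * dirD n (t - x)) (2 * Real.pi) := by
    intro t
    simp only [hper t]
    congr 1
    unfold dirD
    congr 1
    apply Finset.sum_congr rfl
    intro k _
    rw [show (k:ℝ) * (t + 2 * Real.pi - x) = k * (t - x) + k * (2 * Real.pi) by ring,
      Real.cos_add_nat_mul_two_pi]
  have h2 := hp.intervalIntegral_add_eq (-Real.pi) (x - Real.pi)
  rw [show -Real.pi + 2 * Real.pi = Real.pi by ring,
    show x - Real.pi + 2 * Real.pi = x + Real.pi by ring] at h2
  have hi : ∀ a b, IntervalIntegrable (fun t => f t * dirD n (t - x)) MeasureTheory.volume a b :=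
    fun a b => (hall a b).mul_continuousOn
      ((dirD_cont n).comp (continuous_id.sub continuous_const)).continuousOn
  rw [h1, h2, ← intervalIntegral.integral_add_adjacent_intervals (hi _ x) (hi x _), add_comm]
  congr 2
  · have := intervalIntegral.integral_comp_add_left (a := 0) (b := Real.pi)
      (fun t => f t * dirD n (t - x)) x
    simp only [add_sub_cancel_left, add_zero] at this
    exact this.symm
  · have := intervalIntegral.integral_comp_sub_left (a := 0) (b := Real.pi)
      (fun t => f t * dirD n (t - x)) x
    simp only [sub_sub_cancel_left, sub_zero, dirD_even] at this
    exact this.symm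


/-- Refined Dirichlet–Jordan estimate: let `f` be `2π`-periodic with `V_{−π}^{π}(f) ≤ B`
(`B > 0`), and suppose the variation function `v` of `f` near `x` has one-sided local
quasi-moduli bounded by a non-decreasing nonnegative `ω` at `x`, i.e.
`|v(x−0) − v(t)| ≤ ω(δ)` for `t ∈ [x−δ,x)` and `|v(x+0) − v(t)| ≤ ω(δ)` for
`t ∈ (x,x+δ]`, for all `0 < δ ≤ π`. Then for every `n ≥ 1` and `δ ∈ (0,π]`,
`|S_n f(x) − (f(x+0)+f(x−0))/2| ≤ (2B/(πn))(1 + 6 cot(δ/2)) + 16 ω(δ)`. -/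
theorem fourierPartialSum_jump_estimate
    (f : ℝ → ℝ) (hper : Function.Periodic f (2 * Real.pi))
    (B : ℝ) (hB0 : 0 < B)
    (hB : eVariationOn f (Set.Icc (-Real.pi) Real.pi) ≤ ENNReal.ofReal B)
    (x : ℝ)
    (v : ℝ → ℝ)
    (hv : v = fun t => variationOnFromTo f (Set.Icc (x - Real.pi) (x + Real.pi)) (x - Real.pi) t)
    (ω : ℝ → ℝ) (hω : Monotone ω) (hωnn : ∀ δ, 0 ≤ ω δ)
    (fL fR vL vR : ℝ)
    (hfL : Tendsto f (𝓝[<] x) (𝓝 fL)) (hfR : Tendsto f (𝓝[>] x) (𝓝 fR))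
    (hvL : Tendsto v (𝓝[<] x) (𝓝 vL)) (hvR : Tendsto v (𝓝[>] x) (𝓝 vR))
    (hqL : ∀ δ ∈ Set.Ioc (0:ℝ) Real.pi, ∀ t ∈ Set.Ico (x - δ) x, |vL - v t| ≤ ω δ)
    (hqR : ∀ δ ∈ Set.Ioc (0:ℝ) Real.pi, ∀ t ∈ Set.Ioc x (x + δ), |vR - v t| ≤ ω δ)
    (n : ℕ) (hn : 1 ≤ n) (δ : ℝ) (hδ : δ ∈ Set.Ioc (0:ℝ) Real.pi) :
    |fourierPartialSum f n x - (fR + fL) / 2| ≤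
      (2 * B / (Real.pi * n)) * (1 + 6 * (Real.cos (δ/2) / Real.sin (δ/2))) + 16 * ω δ := by
  have hpi := Real.pi_pos
  set S := Icc (x - Real.pi) (x + Real.pi) with hS
  have hV : eVariationOn f S ≤ ENNReal.ofReal B := by rw [hS, evar_period f hper x]; exact hB
  have hbv : BoundedVariationOn f S := ne_top_of_le_ne_top ENNReal.ofReal_ne_top hV
  have hloc : LocallyBoundedVariationOn f S := hbv.locallyBoundedVariationOn
  have h0S : x - Real.pi ∈ S := ⟨le_rfl, by linarith⟩
  have hfv : ∀ s t, x - Real.pi ≤ s → s ≤ t → t ≤ x + Real.pi → |f t - f s| ≤ v t - v s := by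
    intro s t h1 h2 h3
    have hs : s ∈ S := ⟨h1, h2.trans h3⟩
    have ht : t ∈ S := ⟨h1.trans h2, h3⟩
    have e := variationOnFromTo.add hloc h0S hs ht
    have e2 : v t - v s = variationOnFromTo f S s t := by rw [hv]; simp only; linarith
    rw [e2]
    rw [variationOnFromTo.eq_of_le f S h2, ← Real.dist_eq, dist_edist]
    apply ENNReal.toReal_mono (hloc s t hs ht)
    exact eVariationOn.edist_le f ⟨ht, h2, le_rfl⟩ ⟨hs, le_rfl, h2⟩
  have hvB : v (x + Real.pi) - v (x - Real.pi) ≤ B := by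
    rw [hv]
    simp only [variationOnFromTo.self, sub_zero]
    rw [variationOnFromTo.eq_of_le f S (by linarith), ← hS, inter_self]
    exact ENNReal.toReal_le_of_le_ofReal hB0.le hV
  have hδ1 := hδ.1
  have hδ2 := hδ.2
  have tR : Tendsto (fun u : ℝ => x + u) (𝓝[>] 0) (𝓝[>] x) := by
    refine tendsto_nhdsWithin_iff.2 ⟨?_, ?_⟩
    · have : Tendsto (fun u : ℝ => x + u) (𝓝 0) (𝓝 (x + 0)) := (continuous_const.add continuous_id).tendsto 0
      rw [add_zero] at this
      exact this.mono_left nhdsWithin_le_nhds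
    · filter_upwards [self_mem_nhdsWithin] with u hu
      have : (0:ℝ) < u := hu
      show x < x + u
      linarith
  have tL : Tendsto (fun u : ℝ => x - u) (𝓝[>] 0) (𝓝[<] x) := by
    refine tendsto_nhdsWithin_iff.2 ⟨?_, ?_⟩
    · have : Tendsto (fun u : ℝ => x - u) (𝓝 0) (𝓝 (x - 0)) := (continuous_const.sub continuous_id).tendsto 0
      rw [sub_zero] at this
      exact this.mono_left nhdsWithin_le_nhds
    · filter_upwards [self_mem_nhdsWithin] with u hu
      have : (0:ℝ) < u := hu
      show x - u < x
      linarith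
  have R := one_side (fun u => f (x + u)) (fun u => v (x + u)) fR vR δ n hn hδ
    (fun s t h1 h2 h3 => hfv _ _ (by linarith) (by linarith) (by linarith))
    (hfR.comp tR) (hvR.comp tR)
  have L := one_side (fun u => f (x - u)) (fun u => -v (x - u)) fL (-vL) δ n hn hδ
    (fun s t h1 h2 h3 => by
      have := hfv (x - t) (x - s) (by linarith) (by linarith) (by linarith)
      rw [abs_sub_comm] at this
      linarith)
    (hfL.comp tL) (hvL.comp tL).neg
  have hfi := bv_integrable f v (x - Real.pi) (x + Real.pi) (by linarith) hfv
  rw [fps_eq f hper x n hfi]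
  set IR := ∫ u in (0:ℝ)..Real.pi, f (x + u) * dirD n u
  set IL := ∫ u in (0:ℝ)..Real.pi, f (x - u) * dirD n u
  have q1 : v (x + δ) - vR ≤ ω δ := by
    have := hqR δ hδ (x + δ) ⟨by linarith, le_rfl⟩
    linarith [(abs_le.1 this).1]
  have q2 : vL - v (x - δ) ≤ ω δ := by
    have := hqL δ hδ (x - δ) ⟨le_rfl, by linarith⟩
    linarith [(abs_le.1 this).2]
  have hmid : v (x - δ) ≤ v (x + δ) := by
    have := (abs_nonneg _).trans (hfv (x - δ) (x + δ) (by linarith) (by linarith) (by linarith))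
    linarith
  have hsδ : 0 < Real.sin (δ/2) :=
    Real.sin_pos_of_pos_of_lt_pi (by linarith) (by linarith)
  have hcδ : 0 ≤ Real.cos (δ/2) :=
    Real.cos_nonneg_of_neg_pi_div_two_le_of_le (by linarith) (by linarith)
  have hn' : (1:ℝ) ≤ n := by exact_mod_cast hn
  set c := Real.cos (δ/2) / Real.sin (δ/2) with hc
  have hc0 : 0 ≤ c := div_nonneg hcδ hsδ.le
  set M := 1 / (((n:ℝ)+1/2) * Real.sin (δ/2)) with hM
  have hM0 : 0 ≤ M := by positivity
  have hMle : M ≤ (1/n) * (1 + c) := by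
    have hsc : 1 ≤ Real.sin (δ/2) + Real.cos (δ/2) := by
      nlinarith [Real.sin_sq_add_cos_sq (δ/2), mul_nonneg hsδ.le hcδ]
    have e : 1 / (n:ℝ) * (1 + c) = (Real.sin (δ/2) + Real.cos (δ/2)) / (n * Real.sin (δ/2)) := by
      rw [hc]; field_simp
    rw [e, hM]
    have : 0 < (n:ℝ) * Real.sin (δ/2) := by positivity
    gcongr
    linarith
  have hω0 := hωnn δ
  have T : |IR + IL - (fR + fL) * (Real.pi/2)| ≤ 2 * (Real.pi + 1) * ω δ + M * B := by
    have b1 : (Real.pi + 1) * (v (x + δ) - vR) ≤ (Real.pi + 1) * ω δ := by gcongr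
    have b2 : (Real.pi + 1) * (-v (x - δ) - -vL) ≤ (Real.pi + 1) * ω δ := by gcongr; linarith
    have b3 : M * ((v (x + Real.pi) - v (x + δ)) + (-v (x - Real.pi) - -v (x - δ))) ≤ M * B := by
      gcongr; linarith
    rw [abs_le] at R L ⊢
    constructor <;> linarith [R.1, R.2, L.1, L.2]
  have e : 1 / Real.pi * (IR + IL) - (fR + fL) / 2
      = (1 / Real.pi) * (IR + IL - (fR + fL) * (Real.pi/2)) := by field_simp
  rw [e, abs_mul, abs_of_pos (by positivity : 0 < 1 / Real.pi)]
  have hp3 := Real.pi_gt_three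
  calc _ ≤ 1 / Real.pi * (2 * (Real.pi + 1) * ω δ + M * B) := by gcongr
    _ ≤ 1 / Real.pi * (16 * Real.pi * ω δ + (2 / n * (1 + 6 * c)) * B) := by
      have z : 2 * (Real.pi + 1) ≤ 16 * Real.pi := by linarith
      have z2 : M ≤ 2 / n * (1 + 6 * c) := by
        refine hMle.trans ?_
        have : (1:ℝ)/n * (1 + c) ≤ (1/n) * (2 * (1 + 6 * c)) := by gcongr; linarith
        exact this.trans (le_of_eq (by ring))
      exact mul_le_mul_of_nonneg_left (add_le_add (mul_le_mul_of_nonneg_right z hω0)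
        (mul_le_mul_of_nonneg_right z2 hB0.le)) (by positivity)
    _ = _ := by field_simp; ring
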